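/- Let ℓ ≥ 2 be an integer (so that ℓ > 3/2) and let F ∈ C^∞(ℝ) with F(0) = 0. Then there exists a continuous function C : [0,∞) → [0,∞) such that for all f ∈ H^ℓ(T³) ∩ L^∞(T³), the composition satisfies ‖F(f)‖_{H^ℓ} ≤ C(‖f‖_{L^∞}) ‖f‖_{H^ℓ}. -/

import Mathlib

noncomputable section

open MeasureTheory Real Set

/-- Points of the flat torus `T³`, modelled as `ℝ³` (functions are taken ℤ³-periodic). -/
abbrev Pt : Type := Fin 3 → ℝ

/-- The fundamental domain `[0,1)³` of the torus, of unit volume. -/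
def cube : Set Pt := Set.univ.pi fun _ => Set.Ico (0:ℝ) 1

/-- ℤ³-periodicity: the property of descending to the torus `T³`. -/
def Periodic3 (f : Pt → ℝ) : Prop :=
  ∀ (x : Pt) (k : Fin 3 → ℤ), f (fun i => x i + (k i : ℝ)) = f x

/-- The partial derivative `∂_i f`. -/
def pd (i : Fin 3) (f : Pt → ℝ) : Pt → ℝ := fun x => fderiv ℝ f x (Pi.single i 1)

/-- Iterated partial derivatives along a list of directions. -/
def pdIter : List (Fin 3) → (Pt → ℝ) → (Pt → ℝ)
  | [], f => f
  | i :: js, f => pd i (pdIter js f)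

/-- The squared homogeneous Sobolev seminorm `‖∂^k f‖_{L²}²` on the torus. -/
def HdotSq (k : ℕ) (f : Pt → ℝ) : ℝ :=
  ∫ x in cube, ∑ js : Fin k → Fin 3, (pdIter (List.ofFn js) f x) ^ 2

/-- Squared homogeneous seminorm of a vector field. -/
def HdotSqV (k : ℕ) (v : Pt → Pt) : ℝ :=
  ∑ a : Fin 3, HdotSq k (fun x => v x a)

/-- The homogeneous Sobolev seminorm `‖f‖_{Ḣ^k}`. -/
def Hdot (k : ℕ) (f : Pt → ℝ) : ℝ := Real.sqrt (HdotSq k f)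

/-- The Sobolev norm `‖f‖_{H^s}`. -/
def HSob (s : ℕ) (f : Pt → ℝ) : ℝ :=
  Real.sqrt (∑ k ∈ Finset.range (s+1), HdotSq k f)

/-- The Sobolev norm `‖v‖_{H^s}` of a vector field. -/
def HSobV (s : ℕ) (v : Pt → Pt) : ℝ :=
  Real.sqrt (∑ k ∈ Finset.range (s+1), HdotSqV k v)

/-- The norm `‖∂f‖_{H^m}` of the full gradient of `f`. -/
def HSobGrad (m : ℕ) (f : Pt → ℝ) : ℝ :=
  Real.sqrt (∑ k ∈ Finset.range (m+1), HdotSq (k+1) f)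

/-- The mean of `f` over the torus (the fundamental cube has unit volume). -/
def mean (f : Pt → ℝ) : ℝ := ∫ x in cube, f x

/-- The (vector-valued) mean of a vector field. -/
def meanV (v : Pt → Pt) : Pt := fun a => ∫ x in cube, v x a

/-- The `L²` norm of `f` over the torus. -/
def L2norm (f : Pt → ℝ) : ℝ := Real.sqrt (∫ x in cube, (f x) ^ 2)

/-- The `L²` norm of a vector field over the torus. -/
def L2normV (v : Pt → Pt) : ℝ := Real.sqrt (∫ x in cube, ∑ a, (v x a) ^ 2)

/-- The `L^∞` norm of `f`. -/
def LinfNorm (f : Pt → ℝ) : ℝ := ⨆ x : Pt, |f x|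

/-- The `L^∞` norm `‖∂f‖_{L^∞}` of the gradient of `f`. -/
def LinfGrad (f : Pt → ℝ) : ℝ := ⨆ x : Pt, Real.sqrt (∑ i, (pd i f x) ^ 2)

/-- The `L^∞` norm `‖∂v‖_{L^∞}` of the gradient of a vector field. -/
def LinfGradV (v : Pt → Pt) : ℝ :=
  ⨆ x : Pt, Real.sqrt (∑ a, ∑ i, (pd i (fun y => v y a) x) ^ 2)

/-- The density `ρ = t^{-3α} exp L`. -/
def rho (α t : ℝ) (L : Pt → ℝ) : Pt → ℝ := fun x => t ^ (-(3*α)) * Real.exp (L x)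

/-- The mixed inner product `(∂^{ℓ-1} v, ∂^ℓ L)_{L²}`, contracting all matching
indices with the Euclidean metric (for `ℓ = 1` this is `(v, ∂L)_{L²}`). -/
def ipMixed (ℓ : ℕ) (v : Pt → Pt) (L : Pt → ℝ) : ℝ :=
  ∫ x in cube, ∑ js : Fin (ℓ-1) → Fin 3, ∑ a,
    pdIter (List.ofFn js) (fun y => v y a) x * pdIter (List.ofFn js) (pd a L) x

/-- The first-order energy `E₁[v,L](t)` with correction constant `c`. -/
def E1 (K α c t : ℝ) (v : Pt → Pt) (L : Pt → ℝ) : ℝ :=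
  (∑ a, (meanV v a) ^ 2) + HdotSqV 1 v + K * HdotSq 1 L + c * t ^ (α - 1) * ipMixed 1 v L

/-- The homogeneous energy `E_ℓ[v,L](t)` of order `ℓ > 1` with correction constant `c`. -/
def Ehigher (K α c t : ℝ) (ℓ : ℕ) (v : Pt → Pt) (L : Pt → ℝ) : ℝ :=
  HdotSqV ℓ v + K * HdotSq ℓ L + c * t ^ (α - 1) * ipMixed ℓ v L

/-- The total energy `ℰ_s[v,L] = Σ_{k=1}^s E_k[v,L]`. -/
def Etot (K α c t : ℝ) (s : ℕ) (v : Pt → Pt) (L : Pt → ℝ) : ℝ :=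
  E1 K α c t v L + ∑ k ∈ Finset.Icc 2 s, Ehigher K α c t k v L

/-- Smooth periodic solutions of the expansion-normalized Euler–Poisson system on
`[t₀,∞) × T³`:  `∂_t L = −t^{−α} v^i ∂_i L − t^{−α} ∂_i v^i`,
`∂_t v^i = −t^{−α} K δ^{ij} ∂_j L − t^{−α} v^j ∂_j v^i − α t^{−1} v^i + t^{−α} δ^{ij} ∂_j φ`,
`t^{−2α} Δφ = −(ρ − ρ̄)` with `∫ φ = 0`, where `ρ = t^{−3α} exp L`. -/
structure IsEPSolution (α K t₀ : ℝ) (L : ℝ → Pt → ℝ) (v : ℝ → Pt → Pt)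
    (φ : ℝ → Pt → ℝ) : Prop where
  smooth_L : ∀ t ∈ Ici t₀, ContDiff ℝ (⊤ : ℕ∞) (L t)
  smooth_v : ∀ t ∈ Ici t₀, ∀ a, ContDiff ℝ (⊤ : ℕ∞) (fun x => v t x a)
  smooth_φ : ∀ t ∈ Ici t₀, ContDiff ℝ (⊤ : ℕ∞) (φ t)
  periodic_L : ∀ t ∈ Ici t₀, Periodic3 (L t)
  periodic_v : ∀ t ∈ Ici t₀, ∀ a, Periodic3 (fun x => v t x a)
  periodic_φ : ∀ t ∈ Ici t₀, Periodic3 (φ t)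
  eq_L : ∀ t ∈ Ici t₀, ∀ x, HasDerivWithinAt (fun τ => L τ x)
      (-(t ^ (-α)) * (∑ i, v t x i * pd i (L t) x)
        - t ^ (-α) * (∑ i, pd i (fun y => v t y i) x)) (Ici t₀) t
  eq_v : ∀ t ∈ Ici t₀, ∀ x, ∀ i, HasDerivWithinAt (fun τ => v τ x i)
      (-(t ^ (-α)) * K * pd i (L t) x
        - t ^ (-α) * (∑ j, v t x j * pd j (fun y => v t y i) x)
        - α * t⁻¹ * v t x i + t ^ (-α) * pd i (φ t) x) (Ici t₀) t
  eq_φ : ∀ t ∈ Ici t₀, ∀ x,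
      t ^ (-(2*α)) * (∑ i, pd i (pd i (φ t)) x)
        = -(rho α t (L t) x - mean (rho α t (L t)))
  mean_φ : ∀ t ∈ Ici t₀, mean (φ t) = 0

section Torus

lemma ContDiff.pd {f : Pt → ℝ} (hf : ContDiff ℝ (⊤ : ℕ∞) f) (i : Fin 3) :
    ContDiff ℝ (⊤ : ℕ∞) (pd i f) :=
  (hf.fderiv_right (m := (⊤ : ℕ∞)) le_rfl).clm_apply contDiff_const

lemma ContDiff.pdIter {f : Pt → ℝ} (hf : ContDiff ℝ (⊤ : ℕ∞) f) (L : List (Fin 3)) :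
    ContDiff ℝ (⊤ : ℕ∞) (pdIter L f) := by
  induction L with
  | nil => exact hf
  | cons i L ih => exact ih.pd i

lemma Periodic3.pd {f : Pt → ℝ} (hf : Periodic3 f) (i : Fin 3) : Periodic3 (pd i f) := by
  intro x k
  have h : (fun y : Pt => f (y + fun j => (k j : ℝ))) = f := funext fun y => hf y k
  have h' := fderiv_comp_add_right (𝕜 := ℝ) (f := f) (x := x) (fun j => (k j : ℝ))
  rw [h] at h'
  change fderiv ℝ f (x + fun j => (k j : ℝ)) _ = _
  rw [← h']
  rfl

lemma Periodic3.pdIter {f : Pt → ℝ} (hf : Periodic3 f) (L : List (Fin 3)) :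
    Periodic3 (pdIter L f) := by
  induction L with
  | nil => exact hf
  | cons i L ih => exact ih.pd i

lemma cube_ae_eq_Icc : cube =ᵐ[volume] Icc (0 : Pt) 1 := by
  rw [volume_pi]
  exact Measure.univ_pi_Ico_ae_eq_Icc

lemma measurableSet_cube : MeasurableSet cube :=
  MeasurableSet.univ_pi fun _ => measurableSet_Ico

lemma Continuous.integrableOn_cube {f : Pt → ℝ} (hf : Continuous f) : IntegrableOn f cube :=
  (hf.integrableOn_Icc (a := (0 : Pt)) (b := 1)).congr_set_ae cube_ae_eq_Icc

lemma setIntegral_cube_mono {f g : Pt → ℝ} (hf : Continuous f) (hg : Continuous g)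
    (h : ∀ x, f x ≤ g x) : ∫ x in cube, f x ≤ ∫ x in cube, g x :=
  setIntegral_mono hf.integrableOn_cube hg.integrableOn_cube h

/-- The integral over the torus of a partial derivative vanishes. -/
lemma setIntegral_cube_pd_eq_zero {h : Pt → ℝ} (hh : ContDiff ℝ 1 h) (hp : Periodic3 h)
    (i : Fin 3) : ∫ x in cube, pd i h x = 0 := by
  have hd : Differentiable ℝ h := hh.differentiable one_ne_zero
  have hc : Continuous (pd i h) := (hh.continuous_fderiv one_ne_zero).clm_apply continuous_const
  have h1 : ∀ x : Pt, ∑ j, (if j = i then fderiv ℝ h x else 0) (Pi.single j 1) = pd i h x := by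
    intro x
    rw [Finset.sum_eq_single i]
    · simp [pd]
    · intro j _ hj
      simp [hj]
    · simp
  have key := integral_divergence_of_hasFDerivAt_off_countable' (n := 2) (E := ℝ) 0 1 zero_le_one
    (fun j => if j = i then h else 0) (fun j x => if j = i then fderiv ℝ h x else 0) ∅
    countable_empty
    (fun j => by
      split_ifs
      · exact hd.continuous.continuousOn
      · exact continuousOn_const)
    (fun x _ j => by
      split_ifs
      · exact (hd x).hasFDerivAt
      · exact hasFDerivAt_const _ _)
    (by
      simp_rw [h1]
      exact hc.integrableOn_Icc)
  simp_rw [h1] at key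
  rw [setIntegral_congr_set cube_ae_eq_Icc, key]
  refine Finset.sum_eq_zero fun j _ => ?_
  by_cases hj : j = i
  · rw [sub_eq_zero]
    congr 1
    ext x
    simp only [hj, if_true]
    have := hp (Fin.insertNth i (0 : ℝ) x) (Pi.single i 1)
    rw [← hj] at this ⊢
    rw [Pi.zero_apply, ← this]
    congr 1
    ext l
    refine Fin.succAboveCases j ?_ (fun l => ?_) l <;> simp
  · simp [hj]

lemma hasDerivAt_abs_rpow_mul_self {q : ℝ} (hq : 0 < q) (t : ℝ) :
    HasDerivAt (fun t : ℝ => |t| ^ q * t) ((q + 1) * |t| ^ q) t := by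
  rcases eq_or_ne t 0 with rfl | ht
  · rw [hasDerivAt_iff_tendsto_slope]
    have hc : Continuous fun t : ℝ => |t| ^ q := continuous_abs.rpow_const fun _ => Or.inr hq.le
    have h0 : Filter.Tendsto (fun t : ℝ => |t| ^ q) (nhdsWithin 0 {0}ᶜ) (nhds (|0| ^ q)) :=
      hc.continuousAt.tendsto.mono_left nhdsWithin_le_nhds
    rw [abs_zero, zero_rpow hq.ne', mul_zero]
    rw [abs_zero, zero_rpow hq.ne'] at h0
    refine h0.congr' ?_
    filter_upwards [self_mem_nhdsWithin] with t ht
    have ht' : t ≠ 0 := ht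
    simp [slope_def_field, ht']
  · have h1 : HasDerivAt (fun t : ℝ => |t| ^ q) (SignType.sign t * q * |t| ^ (q - 1)) t :=
      (hasDerivAt_abs ht).rpow_const (Or.inl (abs_ne_zero.2 ht))
    refine (h1.mul (hasDerivAt_id t)).congr_deriv ?_
    have h2 : |t| ^ q = |t| ^ (q - 1) * |t| := by
      rw [← rpow_add_one (abs_ne_zero.2 ht)]
      simp
    rw [h2, ← sign_mul_self]
    simp only [id]
    ring

lemma contDiff_abs_rpow_mul_self {q : ℝ} (hq : 0 < q) :
    ContDiff ℝ 1 (fun t : ℝ => |t| ^ q * t) := by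
  rw [contDiff_one_iff_deriv]
  refine ⟨fun t => (hasDerivAt_abs_rpow_mul_self hq t).differentiableAt, ?_⟩
  rw [funext fun t => (hasDerivAt_abs_rpow_mul_self hq t).deriv]
  exact continuous_const.mul (continuous_abs.rpow_const fun _ => Or.inr hq.le)

lemma pd_mul {g h : Pt → ℝ} (hg : Differentiable ℝ g) (hh : Differentiable ℝ h) (i : Fin 3)
    (x : Pt) : pd i (fun y => g y * h y) x = g x * pd i h x + pd i g x * h x := by
  simp only [pd]
  rw [fderiv_fun_mul (hg x) (hh x)]
  simp [mul_comm]

lemma pd_comp {φ : ℝ → ℝ} {φ' : ℝ} {g : Pt → ℝ} {x : Pt} (hφ : HasDerivAt φ φ' (g x))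
    (hg : DifferentiableAt ℝ g x) (i : Fin 3) :
    pd i (fun y => φ (g y)) x = φ' * pd i g x := by
  simp only [pd]
  have := (hφ.comp_hasFDerivAt x hg.hasFDerivAt).fderiv
  simp only [Function.comp_def] at this
  rw [this]
  simp

/-- Integration by parts bound for `‖∂ᵢ g‖_{L^a}^a`. -/
lemma setIntegral_abs_pd_rpow_le {g : Pt → ℝ} (hg : ContDiff ℝ (⊤ : ℕ∞) g) (hp : Periodic3 g)
    (i : Fin 3) {a : ℝ} (ha : 2 < a) :
    ∫ x in cube, |pd i g x| ^ a ≤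
      (a - 1) * ∫ x in cube, |g x| * |pd i g x| ^ (a - 2) * |pd i (pd i g) x| := by
  have hq : 0 < a - 2 := by linarith
  have hg1 := hg.pd i
  have hg2 := hg1.pd i
  have hφ := contDiff_abs_rpow_mul_self hq
  have hφg : ContDiff ℝ 1 (fun y => |pd i g y| ^ (a - 2) * pd i g y) :=
    hφ.comp (hg1.of_le (by exact_mod_cast le_top))
  have hgone : ContDiff ℝ 1 g := hg.of_le (by exact_mod_cast le_top)
  have hzero := setIntegral_cube_pd_eq_zero (hgone.mul hφg)
    (fun x k => by simp only [hp x k, hp.pd i x k]) i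
  have hpow : Continuous fun x => |pd i g x| ^ (a - 2) :=
    hg1.continuous.abs.rpow_const fun _ => Or.inr hq.le
  have hpow' : Continuous fun x => |pd i g x| ^ a :=
    hg1.continuous.abs.rpow_const fun _ => Or.inr (by linarith)
  have hexp : ∀ x, pd i (fun y => g y * (|pd i g y| ^ (a - 2) * pd i g y)) x =
      (a - 1) * (g x * |pd i g x| ^ (a - 2) * pd i (pd i g) x) + |pd i g x| ^ a := by
    intro x
    rw [pd_mul (hgone.differentiable one_ne_zero) (hφg.differentiable one_ne_zero),
      pd_comp (hasDerivAt_abs_rpow_mul_self hq (pd i g x))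
        (hg1.differentiable (by simp) x)]
    have : |pd i g x| ^ a = |pd i g x| ^ (a - 2) * (pd i g x * pd i g x) := by
      rw [← abs_mul_abs_self (pd i g x), ← pow_two, ← rpow_natCast,
        ← rpow_add_of_nonneg (abs_nonneg _) hq.le (by norm_num)]
      norm_num
    rw [this]
    ring
  rw [← integral_const_mul]
  have hc1 : Continuous fun x => (a - 1) * (g x * |pd i g x| ^ (a - 2) * pd i (pd i g) x) :=
    continuous_const.mul ((hg.continuous.mul hpow).mul hg2.continuous)
  have hc2 : Continuous fun x => (a - 1) * (|g x| * |pd i g x| ^ (a - 2) * |pd i (pd i g) x|) :=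
    continuous_const.mul ((hg.continuous.abs.mul hpow).mul hg2.continuous.abs)
  have hz : ∫ x in cube, ((a - 1) * (g x * |pd i g x| ^ (a - 2) * pd i (pd i g) x)
      + |pd i g x| ^ a) = 0 := by
    simpa only [← hexp] using hzero
  rw [integral_add hc1.integrableOn_cube hpow'.integrableOn_cube] at hz
  rw [show ∫ x in cube, |pd i g x| ^ a =
    ∫ x in cube, -((a - 1) * (g x * |pd i g x| ^ (a - 2) * pd i (pd i g) x)) by
      rw [integral_neg]; linarith]
  refine setIntegral_cube_mono hc1.neg hc2 fun x => ?_
  rw [← mul_neg]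
  refine mul_le_mul_of_nonneg_left ((neg_le_abs _).trans ?_) (by linarith)
  rw [abs_mul, abs_mul, abs_of_nonneg (rpow_nonneg (abs_nonneg (pd i g x)) _)]

/-- Weighted Young inequality with small constants on the first two terms. -/
lemma exists_rpow_mul_rpow_mul_rpow_le {w₁ w₂ w₃ δ : ℝ} (hw₁ : 0 ≤ w₁) (hw₂ : 0 ≤ w₂)
    (hw₃ : 0 < w₃) (hw : w₁ + w₂ + w₃ = 1) (hδ : 0 < δ) :
    ∃ C : ℝ, 0 ≤ C ∧ ∀ U X Y : ℝ, 0 ≤ U → 0 ≤ X → 0 ≤ Y →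
      U ^ w₁ * X ^ w₂ * Y ^ w₃ ≤ δ * U + δ * X + C * Y := by
  have hC : 0 ≤ δ ^ (-(w₁ + w₂) / w₃) := rpow_nonneg hδ.le _
  refine ⟨δ ^ (-(w₁ + w₂) / w₃), hC, fun U X Y hU hX hY => ?_⟩
  have h := geom_mean_le_arith_mean3_weighted hw₁ hw₂ hw₃.le (mul_nonneg hδ.le hU)
    (mul_nonneg hδ.le hX) (mul_nonneg hC hY) hw
  rw [mul_rpow hδ.le hU, mul_rpow hδ.le hX, mul_rpow hC hY, ← rpow_mul hδ.le,
    div_mul_cancel₀ _ hw₃.ne'] at h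
  have hone : δ ^ w₁ * δ ^ w₂ * δ ^ (-(w₁ + w₂)) = 1 := by
    rw [← rpow_add hδ, ← rpow_add hδ, add_neg_cancel, rpow_zero]
  calc U ^ w₁ * X ^ w₂ * Y ^ w₃
      = (δ ^ w₁ * δ ^ w₂ * δ ^ (-(w₁ + w₂))) * (U ^ w₁ * X ^ w₂ * Y ^ w₃) := by rw [hone, one_mul]
    _ ≤ w₁ * (δ * U) + w₂ * (δ * X) + w₃ * (δ ^ (-(w₁ + w₂) / w₃) * Y) := by linarith
    _ ≤ _ := add_le_add_three
      (mul_le_of_le_one_left (mul_nonneg hδ.le hU) (by linarith))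
      (mul_le_of_le_one_left (mul_nonneg hδ.le hX) (by linarith))
      (mul_le_of_le_one_left (mul_nonneg hC hY) (by linarith))

/-- The pointwise density `∑_{|J| = j} |∂_J f|^{2k/j}`. -/
def derivPow (k j : ℕ) (f : Pt → ℝ) (x : Pt) : ℝ :=
  ∑ js : Fin j → Fin 3, |pdIter (List.ofFn js) f x| ^ ((2 * k : ℝ) / j)

lemma derivPow_nonneg (k j : ℕ) (f : Pt → ℝ) (x : Pt) : 0 ≤ derivPow k j f x :=
  Finset.sum_nonneg fun _ _ => rpow_nonneg (abs_nonneg _) _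

lemma continuous_derivPow (k j : ℕ) {f : Pt → ℝ} (hf : ContDiff ℝ (⊤ : ℕ∞) f) :
    Continuous (derivPow k j f) :=
  continuous_finsetSum _ fun _ _ =>
    (hf.pdIter _).continuous.abs.rpow_const fun _ => Or.inr (by positivity)

lemma rpow_le_derivPow (k : ℕ) {j : ℕ} (f : Pt → ℝ) (js : Fin j → Fin 3) (x : Pt) :
    |pdIter (List.ofFn js) f x| ^ ((2 * k : ℝ) / j) ≤ derivPow k j f x :=
  Finset.single_le_sum (f := fun js : Fin j → Fin 3 =>
    |pdIter (List.ofFn js) f x| ^ ((2 * k : ℝ) / j))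
    (fun _ _ => rpow_nonneg (abs_nonneg _) _) (Finset.mem_univ js)

lemma HdotSq_eq_setIntegral_derivPow {k : ℕ} (hk : k ≠ 0) (f : Pt → ℝ) :
    HdotSq k f = ∫ x in cube, derivPow k k f x := by
  simp only [HdotSq, derivPow]
  have : (2 * k : ℝ) / k = (2 : ℕ) := by
    have : (k : ℝ) ≠ 0 := by exact_mod_cast hk
    push_cast
    field_simp
  simp_rw [this, rpow_natCast, sq_abs]

/-- One step of the interpolation: the order `m + 1` density is controlled by the order `m + 2`
density, up to small multiples of lower order densities. -/
lemma exists_setIntegral_derivPow_succ_le {k m : ℕ} (hm : m + 2 ≤ k) {R : ℝ} (hR : 1 ≤ R) {δ : ℝ}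
    (hδ : 0 < δ) :
    ∃ C : ℝ, 0 ≤ C ∧ ∀ f : Pt → ℝ, ContDiff ℝ (⊤ : ℕ∞) f → Periodic3 f → (∀ x, |f x| ≤ R) →
      ∫ x in cube, derivPow k (m + 1) f x ≤
        δ * (if m = 0 then 0 else ∫ x in cube, derivPow k m f x) +
        δ * (∫ x in cube, derivPow k (m + 1) f x) + C * ∫ x in cube, derivPow k (m + 2) f x := by
  have hk0 : (0 : ℝ) < k := by exact_mod_cast (by omega : 0 < k)
  have hmk : (m : ℝ) + 2 ≤ k := by exact_mod_cast hm
  have hm0 : (0 : ℝ) ≤ m := Nat.cast_nonneg m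
  set a : ℝ := 2 * k / ((m + 1 : ℕ) : ℝ) with ha_def
  have hm1 : (0 : ℝ) < ((m + 1 : ℕ) : ℝ) := by positivity
  have ha : 2 < a := by
    rw [ha_def, lt_div_iff₀ hm1]
    push_cast
    linarith
  have ha0 : 0 < a := by linarith
  set N : ℝ := 3 ^ (m + 1) * (a - 1) * R with hN_def
  have hN : 0 < N := by
    have : 0 < a - 1 := by linarith
    positivity
  obtain ⟨C, hC, hY⟩ := exists_rpow_mul_rpow_mul_rpow_le (w₁ := m / (2 * k)) (w₂ := (a - 2) / a)
    (w₃ := (m + 2) / (2 * k)) (δ := δ / N) (by positivity)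
    (div_nonneg (by linarith) ha0.le) (by positivity)
    (by
      rw [ha_def]
      push_cast
      field_simp
      ring) (by positivity)
  refine ⟨N * C, by positivity, fun f hf hp hfR => ?_⟩
  set W : Pt → ℝ := fun x => if m = 0 then 0 else derivPow k m f x with hW_def
  have hWc : Continuous W := by
    rw [hW_def]
    split_ifs
    · exact continuous_const
    · exact continuous_derivPow k m hf
  have hW0 : ∀ x, 0 ≤ W x := fun x => by
    rw [hW_def]
    dsimp only
    split_ifs
    · exact le_rfl
    · exact derivPow_nonneg _ _ _ _
  have hWint : ∫ x in cube, W x = if m = 0 then 0 else ∫ x in cube, derivPow k m f x := by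
    rw [hW_def]
    split_ifs <;> simp
  have hD1 := continuous_derivPow k (m + 1) hf
  have hD2 := continuous_derivPow k (m + 2) hf
  have hterm : ∀ js : Fin (m + 1) → Fin 3,
      ∫ x in cube, |pdIter (List.ofFn js) f x| ^ a ≤
        (a - 1) * (R * (δ / N * (∫ x in cube, W x) + δ / N * (∫ x in cube, derivPow k (m + 1) f x)
          + C * ∫ x in cube, derivPow k (m + 2) f x)) := by
    intro js
    have hjs : List.ofFn js = js 0 :: List.ofFn (Fin.tail js) := List.ofFn_succ
    set i := js 0
    set g := pdIter (List.ofFn (Fin.tail js)) f with hg_def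
    have hg : ContDiff ℝ (⊤ : ℕ∞) g := hf.pdIter _
    have h1 : pdIter (List.ofFn js) f = pd i g := by rw [hjs]; rfl
    have h2 : pdIter (List.ofFn (Fin.cons i js : Fin (m + 2) → Fin 3)) f = pd i (pd i g) := by
      rw [List.ofFn_succ]
      simp only [Fin.cons_zero, Fin.cons_succ, pdIter, ← h1]
    rw [h1]
    refine (setIntegral_abs_pd_rpow_le hg (hp.pdIter _) i ha).trans ?_
    refine mul_le_mul_of_nonneg_left ?_ (by linarith)
    have hW' : Continuous fun x => δ / N * W x := hWc.const_mul _
    have hD1' : Continuous fun x => δ / N * derivPow k (m + 1) f x := hD1.const_mul _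
    have hD2' : Continuous fun x => C * derivPow k (m + 2) f x := hD2.const_mul _
    have hWD : Continuous fun x => δ / N * W x + δ / N * derivPow k (m + 1) f x := hW'.add hD1'
    rw [← integral_const_mul, ← integral_const_mul, ← integral_const_mul,
      ← integral_add hW'.integrableOn_cube hD1'.integrableOn_cube,
      ← integral_add hWD.integrableOn_cube hD2'.integrableOn_cube, ← integral_const_mul]
    refine setIntegral_cube_mono
      ((hg.continuous.abs.mul ((hg.pd i).continuous.abs.rpow_const
        fun _ => Or.inr (by linarith))).mul ((hg.pd i).pd i).continuous.abs)
      ((hWD.add hD2').const_mul _) fun x => ?_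
    have hX : |pd i g x| ^ (a - 2) = (|pd i g x| ^ a) ^ ((a - 2) / a) := by
      rw [← rpow_mul (abs_nonneg _), mul_div_cancel₀ _ ha0.ne']
    have hXle : |pd i g x| ^ a ≤ derivPow k (m + 1) f x := by
      have := rpow_le_derivPow k f js x
      rwa [h1] at this
    have hYeq : |pd i (pd i g) x| =
        (|pd i (pd i g) x| ^ ((2 * k : ℝ) / ((m + 2 : ℕ) : ℝ))) ^ ((m + 2 : ℝ) / (2 * k)) := by
      rw [← rpow_mul (abs_nonneg _)]
      push_cast
      rw [div_mul_div_cancel₀ (by positivity), div_self (by positivity), rpow_one]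
    have hYle : |pd i (pd i g) x| ^ ((2 * k : ℝ) / ((m + 2 : ℕ) : ℝ)) ≤ derivPow k (m + 2) f x := by
      have := rpow_le_derivPow k f (Fin.cons i js : Fin (m + 2) → Fin 3) x
      rwa [h2] at this
    have hU : ∃ U, 0 ≤ U ∧ U ≤ W x ∧ |g x| ≤ R * U ^ ((m : ℝ) / (2 * k)) := by
      by_cases hmz : m = 0
      · refine ⟨0, le_rfl, hW0 x, ?_⟩
        subst hmz
        simpa [hg_def, pdIter] using hfR x
      · have hmpos : (0 : ℝ) < m := by exact_mod_cast Nat.pos_of_ne_zero hmz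
        refine ⟨|g x| ^ ((2 * k : ℝ) / m), rpow_nonneg (abs_nonneg _) _, ?_, ?_⟩
        · simp only [hW_def, hmz, if_false]
          exact rpow_le_derivPow k f (Fin.tail js) x
        · rw [← rpow_mul (abs_nonneg _), div_mul_div_cancel₀ hmpos.ne',
            div_self (by positivity), rpow_one]
          exact le_mul_of_one_le_left (abs_nonneg _) hR
    obtain ⟨U, hU0, hUW, hUg⟩ := hU
    have hyoung := hY U _ _ hU0 (rpow_nonneg (abs_nonneg (pd i g x)) a)
      (rpow_nonneg (abs_nonneg (pd i (pd i g) x)) ((2 * k : ℝ) / ((m + 2 : ℕ) : ℝ)))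
    rw [← hX, ← hYeq] at hyoung
    calc |g x| * |pd i g x| ^ (a - 2) * |pd i (pd i g) x|
        ≤ R * U ^ ((m : ℝ) / (2 * k)) * |pd i g x| ^ (a - 2) * |pd i (pd i g) x| := by gcongr
      _ = R * (U ^ ((m : ℝ) / (2 * k)) * |pd i g x| ^ (a - 2) * |pd i (pd i g) x|) := by ring
      _ ≤ _ := mul_le_mul_of_nonneg_left hyoung (by linarith)
      _ ≤ _ := by gcongr
  have hsum : ∫ x in cube, derivPow k (m + 1) f x =
      ∑ js : Fin (m + 1) → Fin 3, ∫ x in cube, |pdIter (List.ofFn js) f x| ^ a :=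
    integral_finsetSum _ fun js _ => Continuous.integrableOn_cube
      ((hf.pdIter _).continuous.abs.rpow_const fun _ => Or.inr ha0.le)
  rw [← hWint]
  calc ∫ x in cube, derivPow k (m + 1) f x
      ≤ ∑ _js : Fin (m + 1) → Fin 3, _ := hsum.trans_le (Finset.sum_le_sum fun js _ => hterm js)
    _ = N * (δ / N * (∫ x in cube, W x) + δ / N * (∫ x in cube, derivPow k (m + 1) f x)
          + C * ∫ x in cube, derivPow k (m + 2) f x) := by
        rw [Finset.sum_const, nsmul_eq_mul, hN_def]
        simp
        ring
    _ = _ := by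
        field_simp

lemma setIntegral_derivPow_nonneg (k j : ℕ) (f : Pt → ℝ) : 0 ≤ ∫ x in cube, derivPow k j f x :=
  integral_nonneg fun x => derivPow_nonneg k j f x

lemma exists_setIntegral_derivPow_le_succ {k : ℕ} {R : ℝ} (hR : 1 ≤ R) (m : ℕ) (hm : m + 2 ≤ k) :
    ∃ C : ℝ, 0 ≤ C ∧ ∀ f : Pt → ℝ, ContDiff ℝ (⊤ : ℕ∞) f → Periodic3 f → (∀ x, |f x| ≤ R) →
      ∫ x in cube, derivPow k (m + 1) f x ≤ C * ∫ x in cube, derivPow k (m + 2) f x := by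
  induction m with
  | zero =>
    obtain ⟨C, hC, h⟩ := exists_setIntegral_derivPow_succ_le hm hR (δ := 1 / 2) (by norm_num)
    refine ⟨2 * C, by positivity, fun f hf hp hfR => ?_⟩
    have := h f hf hp hfR
    simp only [if_true] at this
    linarith
  | succ m ih =>
    obtain ⟨C₀, hC₀, h₀⟩ := ih (by omega)
    obtain ⟨C, hC, h⟩ := exists_setIntegral_derivPow_succ_le hm hR (δ := 1 / (2 * (C₀ + 1)))
      (by positivity)
    refine ⟨2 * C, by positivity, fun f hf hp hfR => ?_⟩
    have h1 := h f hf hp hfR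
    have h2 := h₀ f hf hp hfR
    simp only [Nat.add_eq_zero_iff, one_ne_zero, and_false, if_false] at h1
    have h3 : 1 / (2 * (C₀ + 1)) * (∫ x in cube, derivPow k (m + 1) f x) +
        1 / (2 * (C₀ + 1)) * (∫ x in cube, derivPow k (m + 1 + 1) f x) ≤
        1 / 2 * ∫ x in cube, derivPow k (m + 1 + 1) f x := by
      rw [← mul_add, div_mul_eq_mul_div, div_le_iff₀ (by positivity)]
      have : m + 2 = m + 1 + 1 := rfl
      rw [this] at h2
      linarith
    linarith

/-- Gagliardo–Nirenberg type bound, with a constant depending on the sup norm. -/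
lemma exists_setIntegral_derivPow_le {k : ℕ} {R : ℝ} (hR : 1 ≤ R) {j : ℕ} (hj : j ≠ 0)
    (hjk : j ≤ k) :
    ∃ C : ℝ, 0 ≤ C ∧ ∀ f : Pt → ℝ, ContDiff ℝ (⊤ : ℕ∞) f → Periodic3 f → (∀ x, |f x| ≤ R) →
      ∫ x in cube, derivPow k j f x ≤ C * HdotSq k f := by
  revert hj
  induction hjk using Nat.decreasingInduction with
  | self =>
    intro hj
    exact ⟨1, zero_le_one, fun f _ _ _ => by rw [one_mul, HdotSq_eq_setIntegral_derivPow hj]⟩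
  | of_succ j hjk ih =>
    intro hj
    obtain ⟨m, rfl⟩ := Nat.exists_eq_succ_of_ne_zero hj
    obtain ⟨C₁, hC₁, h₁⟩ := ih (by omega)
    obtain ⟨C₂, hC₂, h₂⟩ := exists_setIntegral_derivPow_le_succ hR m hjk
    refine ⟨C₂ * C₁, by positivity, fun f hf hp hfR => (h₂ f hf hp hfR).trans ?_⟩
    rw [mul_assoc]
    exact mul_le_mul_of_nonneg_left (h₁ f hf hp hfR) hC₂

lemma pdIter_ofFn_eq_iteratedFDeriv {f : Pt → ℝ} (hf : ContDiff ℝ (⊤ : ℕ∞) f) {j : ℕ}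
    (js : Fin j → Fin 3) (x : Pt) :
    pdIter (List.ofFn js) f x = iteratedFDeriv ℝ j f x fun l => Pi.single (js l) 1 := by
  induction j generalizing x with
  | zero => simp [pdIter]
  | succ j ih =>
    have hd : DifferentiableAt ℝ (iteratedFDeriv ℝ j f) x :=
      (hf.differentiable_iteratedFDeriv (by exact_mod_cast ENat.natCast_lt_top j)) x
    rw [hd.iteratedFDeriv_succ_apply_left', List.ofFn_succ]
    simp only [pdIter, pd]
    rw [funext fun y => ih (fun l => js l.succ) y]
    rfl

lemma abs_pdIter_ofFn_le {f : Pt → ℝ} (hf : ContDiff ℝ (⊤ : ℕ∞) f) {j : ℕ}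
    (js : Fin j → Fin 3) (x : Pt) :
    |pdIter (List.ofFn js) f x| ≤ ‖iteratedFDeriv ℝ j f x‖ := by
  rw [pdIter_ofFn_eq_iteratedFDeriv hf, ← Real.norm_eq_abs]
  refine ((iteratedFDeriv ℝ j f x).le_opNorm _).trans_eq ?_
  simp [Pi.norm_single]

lemma norm_iteratedFDeriv_le_sum {f : Pt → ℝ} (hf : ContDiff ℝ (⊤ : ℕ∞) f) (j : ℕ) (x : Pt) :
    ‖iteratedFDeriv ℝ j f x‖ ≤ ∑ js : Fin j → Fin 3, |pdIter (List.ofFn js) f x| := by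
  refine ContinuousMultilinearMap.opNorm_le_bound
    (Finset.sum_nonneg fun _ _ => abs_nonneg _) fun v => ?_
  have hv : v = fun l => ∑ i, v l i • (Pi.single i 1 : Pt) := by
    ext l i
    simp [Finset.sum_apply, Pi.single_apply]
  have hexp : iteratedFDeriv ℝ j f x v =
      ∑ js : Fin j → Fin 3, (∏ l, v l (js l)) * pdIter (List.ofFn js) f x := by
    conv_lhs => rw [hv]
    rw [ContinuousMultilinearMap.map_sum]
    refine Finset.sum_congr rfl fun js _ => ?_
    rw [ContinuousMultilinearMap.map_smul_univ, pdIter_ofFn_eq_iteratedFDeriv hf, smul_eq_mul]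
  rw [hexp, Finset.sum_mul]
  refine (norm_sum_le _ _).trans (Finset.sum_le_sum fun js _ => ?_)
  rw [norm_mul, mul_comm, Real.norm_eq_abs (pdIter _ _ _), norm_prod]
  gcongr with l
  exact norm_le_pi_norm (v l) (js l)

/-- Pointwise control of the derivatives of a composition. -/
lemma exists_derivPow_comp_le {F : ℝ → ℝ} (hF : ContDiff ℝ (⊤ : ℕ∞) F) {k : ℕ} (hk : k ≠ 0)
    (R : ℝ) :
    ∃ C : ℝ, 0 ≤ C ∧ ∀ f : Pt → ℝ, ContDiff ℝ (⊤ : ℕ∞) f → (∀ x, |f x| ≤ R) → ∀ x,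
      derivPow k k (fun y => F (f y)) x ≤ C * ∑ j ∈ Finset.Icc 1 k, derivPow k j f x := by
  have hFc : ∀ i : ℕ, ∃ A, ∀ y ∈ Icc (-R) R, ‖iteratedFDeriv ℝ i F y‖ ≤ A := fun i =>
    isCompact_Icc.exists_bound_of_continuousOn
      (hF.continuous_iteratedFDeriv (by exact_mod_cast le_top)).continuousOn
  choose A hA using hFc
  set B : ℝ := ∑ i ∈ Finset.range (k + 1), |A i| with hB_def
  have hB : 0 ≤ B := Finset.sum_nonneg fun _ _ => abs_nonneg _
  refine ⟨3 ^ k * ((k.factorial * B) ^ 2 * 9 ^ k), by positivity, fun f hf hfR x => ?_⟩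
  set S := ∑ j ∈ Finset.Icc 1 k, derivPow k j f x with hS_def
  have hS : 0 ≤ S := Finset.sum_nonneg fun _ _ => derivPow_nonneg _ _ _ _
  have hk0 : (0 : ℝ) < k := by exact_mod_cast Nat.pos_of_ne_zero hk
  set D : ℝ := 3 * S ^ (1 / (2 * k : ℝ)) with hD_def
  have hD : ∀ j, 1 ≤ j → j ≤ k → ‖iteratedFDeriv ℝ j f x‖ ≤ D ^ j := by
    intro j hj hjk
    have hj0 : (0 : ℝ) < j := by exact_mod_cast hj
    have hterm : ∀ js : Fin j → Fin 3,
        |pdIter (List.ofFn js) f x| ≤ (S ^ (1 / (2 * k : ℝ))) ^ j := by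
      intro js
      have h1 : |pdIter (List.ofFn js) f x| ^ ((2 * k : ℝ) / j) ≤ S :=
        (rpow_le_derivPow k f js x).trans (Finset.single_le_sum (f := fun j => derivPow k j f x)
          (fun _ _ => derivPow_nonneg _ _ _ _) (Finset.mem_Icc.2 ⟨hj, hjk⟩))
      have h2 := rpow_le_rpow (rpow_nonneg (abs_nonneg _) _) h1
        (by positivity : (0 : ℝ) ≤ (j : ℝ) / (2 * k))
      rw [← rpow_mul (abs_nonneg _), div_mul_div_cancel₀ hj0.ne', div_self (by positivity),
        rpow_one] at h2
      rw [← rpow_mul_natCast hS, one_div_mul_eq_div]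
      exact h2
    refine (norm_iteratedFDeriv_le_sum hf j x).trans
      ((Finset.sum_le_sum fun js _ => hterm js).trans_eq ?_)
    rw [Finset.sum_const, nsmul_eq_mul, hD_def, mul_pow]
    simp
  have hcomp := norm_iteratedFDeriv_comp_le (n := k) hF hf (by exact_mod_cast le_top) x (C := B)
    (fun i hi => (hA i (f x) (abs_le.1 (hfR x))).trans ((le_abs_self _).trans
      (Finset.single_le_sum (f := fun i => |A i|) (fun _ _ => abs_nonneg _)
        (Finset.mem_range.2 (by omega))))) hD
  have hFf : ContDiff ℝ (⊤ : ℕ∞) fun y => F (f y) := hF.comp hf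
  have hexp : (2 * k : ℝ) / k = (2 : ℕ) := by
    push_cast
    field_simp
  have hDpow : (D ^ k) ^ 2 = 9 ^ k * S := by
    have : (S ^ (1 / (2 * k : ℝ))) ^ (k * 2) = S := by
      rw [← rpow_mul_natCast hS]
      push_cast
      rw [mul_comm (k : ℝ) 2, one_div_mul_cancel (by positivity), rpow_one]
    rw [hD_def, ← pow_mul, mul_pow, this, mul_comm k 2, pow_mul]
    norm_num
  calc derivPow k k (fun y => F (f y)) x
      ≤ ∑ _js : Fin k → Fin 3, (k.factorial * B) ^ 2 * 9 ^ k * S := by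
        refine Finset.sum_le_sum fun js _ => ?_
        rw [hexp, rpow_natCast, mul_assoc, ← hDpow, ← mul_pow]
        exact pow_le_pow_left₀ (abs_nonneg _) ((abs_pdIter_ofFn_le hFf js x).trans hcomp) 2
    _ = _ := by
        rw [Finset.sum_const, nsmul_eq_mul]
        simp
        ring

lemma exists_HdotSq_comp_le_of_ne_zero {F : ℝ → ℝ} (hF : ContDiff ℝ (⊤ : ℕ∞) F) {k : ℕ}
    (hk : k ≠ 0) {R : ℝ} (hR : 1 ≤ R) :
    ∃ C : ℝ, 0 ≤ C ∧ ∀ f : Pt → ℝ, ContDiff ℝ (⊤ : ℕ∞) f → Periodic3 f → (∀ x, |f x| ≤ R) →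
      HdotSq k (fun x => F (f x)) ≤ C * HdotSq k f := by
  obtain ⟨C, hC, h⟩ := exists_derivPow_comp_le hF hk R
  have hGN : ∀ j : ℕ, ∃ K : ℝ, 0 ≤ K ∧ (j ∈ Finset.Icc 1 k → ∀ f : Pt → ℝ,
      ContDiff ℝ (⊤ : ℕ∞) f → Periodic3 f → (∀ x, |f x| ≤ R) →
        ∫ x in cube, derivPow k j f x ≤ K * HdotSq k f) := by
    intro j
    by_cases hj : j ∈ Finset.Icc 1 k
    · obtain ⟨hj1, hjk⟩ := Finset.mem_Icc.1 hj
      obtain ⟨K, hK, hKf⟩ := exists_setIntegral_derivPow_le hR (by omega : j ≠ 0) hjk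
      exact ⟨K, hK, fun _ => hKf⟩
    · exact ⟨0, le_rfl, fun hj' => absurd hj' hj⟩
  choose K hK hKf using hGN
  refine ⟨C * ∑ j ∈ Finset.Icc 1 k, K j, mul_nonneg hC (Finset.sum_nonneg fun j _ => hK j),
    fun f hf hp hfR => ?_⟩
  have hc : Continuous fun x => ∑ j ∈ Finset.Icc 1 k, derivPow k j f x :=
    continuous_finsetSum _ fun j _ => continuous_derivPow k j hf
  calc HdotSq k (fun x => F (f x))
      = ∫ x in cube, derivPow k k (fun y => F (f y)) x := HdotSq_eq_setIntegral_derivPow hk _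
    _ ≤ ∫ x in cube, C * ∑ j ∈ Finset.Icc 1 k, derivPow k j f x :=
        setIntegral_cube_mono (continuous_derivPow k k (hF.comp hf)) (hc.const_mul C) (h f hf hfR)
    _ = C * ∑ j ∈ Finset.Icc 1 k, ∫ x in cube, derivPow k j f x := by
        rw [integral_const_mul, integral_finsetSum _ fun j _ =>
          (continuous_derivPow k j hf).integrableOn_cube]
    _ ≤ C * ∑ j ∈ Finset.Icc 1 k, K j * HdotSq k f :=
        mul_le_mul_of_nonneg_left
          (Finset.sum_le_sum fun j hj => hKf j hj f hf hp hfR) hC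
    _ = _ := by rw [← Finset.sum_mul, mul_assoc]

lemma exists_HdotSq_zero_comp_le {F : ℝ → ℝ} (hF : ContDiff ℝ (⊤ : ℕ∞) F) (hF0 : F 0 = 0)
    {R : ℝ} (hR : 0 ≤ R) :
    ∃ C : ℝ, 0 ≤ C ∧ ∀ f : Pt → ℝ, ContDiff ℝ (⊤ : ℕ∞) f → (∀ x, |f x| ≤ R) →
      HdotSq 0 (fun x => F (f x)) ≤ C * HdotSq 0 f := by
  obtain ⟨A, hA⟩ := isCompact_Icc.exists_bound_of_continuousOn (s := Icc (-R) R)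
    (hF.continuous_deriv (by simp)).continuousOn
  refine ⟨A ^ 2, sq_nonneg _, fun f hf hfR => ?_⟩
  simp only [HdotSq, Finset.univ_unique, List.ofFn_zero, pdIter, Finset.sum_singleton]
  rw [← integral_const_mul]
  refine setIntegral_cube_mono ((hF.comp hf).continuous.pow 2)
    ((hf.continuous.pow 2).const_mul _) fun x => ?_
  have h := (convex_Icc (-R) R).norm_image_sub_le_of_norm_deriv_le
    (fun y _ => (hF.differentiable (by simp)) y) hA
    (mem_Icc.2 ⟨by linarith, hR⟩) (abs_le.1 (hfR x))
  rw [hF0, sub_zero, sub_zero] at h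
  rw [← mul_pow, ← sq_abs, ← sq_abs (A * f x)]
  refine pow_le_pow_left₀ (abs_nonneg _) ?_ 2
  rw [abs_mul]
  exact h.trans (mul_le_mul_of_nonneg_right (le_abs_self _) (norm_nonneg _))

lemma HdotSq_nonneg (k : ℕ) (f : Pt → ℝ) : 0 ≤ HdotSq k f :=
  integral_nonneg fun _ => Finset.sum_nonneg fun _ _ => sq_nonneg _

/-- Composition estimate with a constant that is uniform on sup norm balls. -/
lemma exists_HSob_comp_le {F : ℝ → ℝ} (hF : ContDiff ℝ (⊤ : ℕ∞) F) (hF0 : F 0 = 0) (s : ℕ)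
    {R : ℝ} (hR : 1 ≤ R) :
    ∃ C : ℝ, 0 ≤ C ∧ ∀ f : Pt → ℝ, ContDiff ℝ (⊤ : ℕ∞) f → Periodic3 f → (∀ x, |f x| ≤ R) →
      HSob s (fun x => F (f x)) ≤ C * HSob s f := by
  have hk : ∀ k : ℕ, ∃ C : ℝ, 0 ≤ C ∧ ∀ f : Pt → ℝ, ContDiff ℝ (⊤ : ℕ∞) f → Periodic3 f →
      (∀ x, |f x| ≤ R) → HdotSq k (fun x => F (f x)) ≤ C * HdotSq k f := by
    intro k
    rcases eq_or_ne k 0 with rfl | hk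
    · obtain ⟨C, hC, h⟩ := exists_HdotSq_zero_comp_le hF hF0 (zero_le_one.trans hR)
      exact ⟨C, hC, fun f hf _ => h f hf⟩
    · exact exists_HdotSq_comp_le_of_ne_zero hF hk hR
  choose K hK h using hk
  refine ⟨√(∑ k ∈ Finset.range (s + 1), K k), sqrt_nonneg _, fun f hf hp hfR => ?_⟩
  rw [HSob, HSob, ← sqrt_mul (Finset.sum_nonneg fun k _ => hK k), Finset.mul_sum]
  refine sqrt_le_sqrt (Finset.sum_le_sum fun k hk => (h k f hf hp hfR).trans ?_)
  exact mul_le_mul_of_nonneg_right (Finset.single_le_sum (fun k _ => hK k) hk) (HdotSq_nonneg k f)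

lemma abs_le_LinfNorm {f : Pt → ℝ} (hf : Continuous f) (hp : Periodic3 f) (x : Pt) :
    |f x| ≤ LinfNorm f := by
  refine le_ciSup (f := fun x => |f x|) ?_ x
  obtain ⟨A, hA⟩ := isCompact_Icc.exists_bound_of_continuousOn (s := Icc (0 : Pt) 1)
    hf.continuousOn
  refine ⟨A, ?_⟩
  rintro _ ⟨y, rfl⟩
  dsimp only
  have h := hp (fun i => Int.fract (y i)) fun i => ⌊y i⌋
  simp only [Int.fract_add_floor] at h
  rw [h]
  exact hA _ ⟨fun i => Int.fract_nonneg _, fun i => (Int.fract_lt_one _).le⟩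

end Torus

/-- Moser composition estimate: for an integer `ℓ ≥ 2` and a smooth
`F : ℝ → ℝ` with `F(0) = 0`, there is a continuous function `C : [0,∞) → [0,∞)` such
that `‖F(f)‖_{H^ℓ} ≤ C(‖f‖_{L^∞}) ‖f‖_{H^ℓ}` for all `f ∈ H^ℓ(T³) ∩ L^∞(T³)`. -/
theorem statement6 (ℓ : ℕ) (hℓ : 2 ≤ ℓ) (F : ℝ → ℝ)
    (hF : ContDiff ℝ (⊤ : ℕ∞) F) (hF0 : F 0 = 0) :
    ∃ C : ℝ → ℝ, ContinuousOn C (Ici 0) ∧ (∀ y ∈ Ici (0:ℝ), 0 ≤ C y) ∧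
      ∀ f : Pt → ℝ, ContDiff ℝ (⊤ : ℕ∞) f → Periodic3 f →
        HSob ℓ (fun x => F (f x)) ≤ C (LinfNorm f) * HSob ℓ f := by
  obtain ⟨C, hC⟩ := exists_continuous_forall_mem_convex_of_local_const (X := ℝ) (E := ℝ)
    (t := fun y => {c : ℝ | 0 ≤ c ∧ ∀ f : Pt → ℝ, ContDiff ℝ (⊤ : ℕ∞) f → Periodic3 f →
      LinfNorm f = y → HSob ℓ (fun x => F (f x)) ≤ c * HSob ℓ f})
    (fun y => by
      refine OrdConnected.convex ⟨fun a ha b _ c hc => ⟨ha.1.trans hc.1, fun f hf hp hy => ?_⟩⟩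
      exact (ha.2 f hf hp hy).trans (mul_le_mul_of_nonneg_right hc.1 (sqrt_nonneg _)))
    (fun y => by
      obtain ⟨c, hc, h⟩ := exists_HSob_comp_le hF hF0 ℓ (R := |y| + 1)
        (by linarith [abs_nonneg y])
      refine ⟨c, ?_⟩
      filter_upwards [Iio_mem_nhds (show y < |y| + 1 by linarith [le_abs_self y])] with z hz
      exact ⟨hc, fun f hf hp hfz => h f hf hp fun x =>
        (abs_le_LinfNorm hf.continuous hp x).trans (hfz.trans_le (le_of_lt hz))⟩)
  exact ⟨C, C.continuous.continuousOn, fun y _ => (hC y).1,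
    fun f hf hp => (hC (LinfNorm f)).2 f hf hp rfl⟩
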